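/- Let h be an orientation-preserving homeomorphism of the plane fixing only 0, and suppose the module of h is at least 4. Then h has no periodic point of period 2: there is no point x ≠ 0 with h(x) ≠ x and h(h(x)) = x. -/

import Mathlib

open Set

/-- A curve `γ` (defined on `[0,1]`) with values in `ℂ ∖ {0}` has degree `n` around `0`
if it lifts through the covering `exp : ℂ → ℂ ∖ {0}` to a path whose endpoints differ
by `2πin`. -/
def HasDeg (γ : ℝ → ℂ) (n : ℤ) : Prop :=
  ∃ g : ℝ → ℂ, ContinuousOn g (Icc 0 1) ∧
    (∀ t ∈ Icc (0:ℝ) 1, γ t = Complex.exp (g t)) ∧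
    g 1 - g 0 = ((2 * Real.pi * (n : ℝ) : ℝ) : ℂ) * Complex.I

/-- A loop in `ℝ² ∖ {0}`: a continuous closed curve on `[0,1]` avoiding the origin. -/
def IsLoopIn (γ : ℝ → ℂ) : Prop :=
  ContinuousOn γ (Icc 0 1) ∧ γ 0 = γ 1 ∧ ∀ t ∈ Icc (0:ℝ) 1, γ t ≠ 0

/-- A decomposition of the closed curve `γ` into `l` subarcs, each of which is free for
`h` (disjoint from its image under `h`). The `h`-length of `γ` is the least such `l`. -/
def Decomp (h : ℂ → ℂ) (γ : ℝ → ℂ) (l : ℕ) : Prop :=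
  ∃ t : ℕ → ℝ, t 0 = 0 ∧ t l = 1 ∧ (∀ i < l, t i ≤ t (i + 1)) ∧
    ∀ i < l, ∀ s ∈ Icc (t i) (t (i + 1)), ∀ s' ∈ Icc (t i) (t (i + 1)),
      h (γ s) ≠ γ s'

/-- Orientation preservation, encoded (via Kneser's theorem) as being isotopic to the
identity through bijections of the plane. -/
def IsotopicToId (h : ℂ → ℂ) : Prop :=
  ∃ F : ℝ → ℂ → ℂ, Continuous (Function.uncurry F) ∧ F 0 = id ∧ F 1 = h ∧
    ∀ t : ℝ, Function.Bijective (F t)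


theorem exists_log {X : Type*} [NormedAddCommGroup X] [NormedSpace ℝ X] (f : X → ℂ)
    (hf : Continuous f) (h0 : ∀ x, f x ≠ 0) :
    ∃ L : X → ℂ, Continuous L ∧ ∀ x, Complex.exp (L x) = f x := by
  obtain ⟨F, ⟨-, hF⟩, -⟩ := Complex.isCoveringMapOn_exp.existsUnique_continuousMap_lifts
    (A := X) (a₀ := 0) (e₀ := Complex.log (f 0)) ⟨f, hf⟩ (by simp [Complex.exp_log (h0 0)])
    (fun a => by simpa using h0 a)
  exact ⟨F, F.continuous, fun x => congrFun hF x⟩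

/-- A continuous function whose values differ by multiples of `2πi` is constant. -/
theorem const_of_exp {X : Type*} [TopologicalSpace X] [PreconnectedSpace X] (a : X → ℂ)
    (ha : Continuous a) (c : ℂ) (h : ∀ x, Complex.exp (a x) = c) (x y : X) : a x = a y := by
  have := Complex.isCoveringMap_exp.eq_of_comp_eq (g₁ := a) (g₂ := fun _ => a y) ha
    continuous_const (by ext z; simp [h]) y rfl
  exact congrFun this x

theorem diff_of_exp (a b : ℝ → ℂ) (ha : Continuous a) (hb : Continuous b) (k : ℂ)
    (h : ∀ t, Complex.exp (a t) = k * Complex.exp (b t)) (s t : ℝ) : a s - a t = b s - b t := by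
  have := const_of_exp (fun t => a t - b t) (ha.sub hb) k (fun t => by
    rw [Complex.exp_sub, h]; field_simp [Complex.exp_ne_zero]) s t
  linear_combination this

/-- Key lemma: no periodic free chain of period two for a fixed point free map isotopic to id. -/
theorem no_two_chain (I : ℝ → ℂ → ℂ) (hI : Continuous (Function.uncurry I)) (h0 : ∀ z, I 0 z = z)
    (hinj : ∀ t, Function.Injective (I t)) (hfix : ∀ z, I 1 z ≠ z)
    (σ : ℝ → ℂ) (hσ : Continuous σ) (hfree : ∀ u v, I 1 (σ u) ≠ σ v)
    (hper : I 1 (I 1 (σ 1)) = σ 0) : False := by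
  set f := I 1 with hf
  have hIc : ∀ {Y : Type} [TopologicalSpace Y] {p : Y → ℝ} {q : Y → ℂ}, Continuous p → Continuous q →
      Continuous fun y => I (p y) (q y) := fun hp hq => hI.comp (hp.prodMk hq)
  have hfc : Continuous f := by rw [hf]; exact hIc continuous_const continuous_id
  let W : ℝ → ℂ := fun s => σ 1 + s * (f (σ 1) - σ 1)
  have hW : Continuous W := by fun_prop
  have hW0 : W 0 = σ 1 := by simp [W]
  have hW1 : W 1 = f (σ 1) := by simp [W]
  obtain ⟨l, hlc, hl⟩ := exists_log (fun z => f z - z) (by fun_prop) (fun z => sub_ne_zero.2 (hfix z))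
  obtain ⟨M, hMc, hM⟩ := exists_log (fun p : ℝ × ℝ => f (σ p.1) - σ p.2) (by fun_prop)
    (fun p => sub_ne_zero.2 (hfree _ _))
  obtain ⟨Λ, hΛc, hΛ⟩ := exists_log (fun p : ℝ × ℝ => I p.1 (f (W p.2)) - I p.1 (W p.2))
    ((hIc (by fun_prop) (by fun_prop)).sub (hIc (by fun_prop) (by fun_prop)))
    (fun p => sub_ne_zero.2 (fun h => hfix _ (hinj _ h)))
  obtain ⟨N, hNc, hN⟩ := exists_log (fun p : ℝ × ℝ => I p.1 (σ p.2) - I p.1 (f (σ 1)))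
    ((hIc (by fun_prop) (by fun_prop)).sub (hIc (by fun_prop) (by fun_prop)))
    (fun p => sub_ne_zero.2 (fun h => hfree _ _ (hinj _ h).symm))
  have hc : ∀ t, Complex.exp (Λ (t, 1) - Λ (t, 0) + (N (t, 1) - N (t, 0))) = -1 := by
    intro t
    rw [Complex.exp_add, Complex.exp_sub, Complex.exp_sub, hΛ, hΛ, hN, hN]
    simp only [hW0, hW1, hper]
    have h1 : I t (σ 0) - I t (f (σ 1)) ≠ 0 := sub_ne_zero.2 (fun h => hfree _ _ (hinj _ h).symm)
    have h2 : I t (f (σ 1)) - I t (σ 1) ≠ 0 := sub_ne_zero.2 (fun h => hfix _ (hinj _ h))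
    field_simp
    ring
  have hcc := const_of_exp (fun t : ℝ => Λ (t, 1) - Λ (t, 0) + (N (t, 1) - N (t, 0)))
    (by fun_prop) (-1) hc 1 0
  have e1 := diff_of_exp (fun s => Λ (0, s)) (fun s => l (W s)) (by fun_prop) (by fun_prop) 1
    (fun t => by rw [hΛ, hl]; simp [h0]) 1 0
  have e2 := diff_of_exp (fun s => Λ (1, s)) (fun s => l (f (W s))) (by fun_prop) (by fun_prop) 1
    (fun t => by rw [hΛ, hl]; simp [hf]) 1 0
  have e3 := diff_of_exp (fun s => N (0, s)) (fun s => M (1, s)) (by fun_prop) (by fun_prop) (-1)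
    (fun t => by rw [hN, hM]; simp [h0]) 1 0
  have e4 := diff_of_exp (fun s => N (1, s)) (fun s => M (s, 0)) (by fun_prop) (by fun_prop) 1
    (fun t => by rw [hN, hM]; simp [← hf, hper]) 1 0
  have e5 := diff_of_exp (fun s => l (σ s)) (fun s => M (s, s)) (by fun_prop) (by fun_prop) 1
    (fun t => by rw [hl, hM]; simp) 1 0
  simp only [hW0, hW1, hper] at e1 e2 e3 e4 e5 hcc
  have hz : Λ (0, 1) - Λ (0, 0) + (N (0, 1) - N (0, 0)) = 0 := by
    linear_combination (-hcc + e1 + e2 + e3 + e4 - e5) / 2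
  have := hc 0
  rw [hz] at this
  norm_num at this

/-- A Poincaré–Miranda type statement. -/
theorem miranda (Φ : ℝ × ℝ → ℂ) (hΦ : Continuous Φ) (N a b : ℝ) 
    (ha : ∀ s, 0 ≤ (Φ (s, a)).re) (hb : ∀ s, (Φ (s, b)).re ≤ 0)
    (hp : ∀ t, 0 < (Φ (N, t)).im) (hm : ∀ t, (Φ (-N, t)).im < 0) : ∃ p, Φ p = 0 := by
  by_contra! hne
  obtain ⟨L, hLc, hL⟩ := exists_log Φ hΦ hne
  have key : ∀ (q : ℝ → ℝ × ℝ), Continuous q → ∀ (k : ℂ), k ≠ 0 →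
      (∀ t, k * Φ (q t) ∈ Complex.slitPlane) → ∀ s t,
      L (q s) - L (q t) = Complex.log (k * Φ (q s)) - Complex.log (k * Φ (q t)) := by
    intro q hq k hk hs s t
    refine diff_of_exp (fun t => L (q t)) (fun t => Complex.log (k * Φ (q t))) (by fun_prop)
      (Continuous.clog (by fun_prop) hs) k⁻¹ (fun t => ?_) s t
    rw [hL, Complex.exp_log (mul_ne_zero hk (hne _))]
    field_simp
  have hsl : ∀ z : ℂ, 0 ≤ z.re → z ≠ 0 → z ∈ Complex.slitPlane := by
    intro z hz h0
    rw [Complex.mem_slitPlane_iff]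
    by_contra! h
    exact h0 (Complex.ext (by simpa using le_antisymm h.1 hz) (by simpa using h.2))
  have e1 := key (fun t => (N, t)) (by fun_prop) 1 one_ne_zero (fun t => by
    rw [Complex.mem_slitPlane_iff]; right; simpa using (hp t).ne') b a
  have e2 := key (fun t => (-N, t)) (by fun_prop) 1 one_ne_zero (fun t => by
    rw [Complex.mem_slitPlane_iff]; right; simpa using (hm t).ne) b a
  have e3 := key (fun s => (s, a)) (by fun_prop) 1 one_ne_zero (fun s => by
    simpa using hsl _ (ha s) (hne _)) N (-N)
  have e4 := key (fun s => (s, b)) (by fun_prop) (-1) (by norm_num) (fun s => by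
    refine hsl _ ?_ (by simpa using hne _)
    simpa using hb s) N (-N)
  have l1 : Complex.log (-Φ (N, b)) = Complex.log (Φ (N, b)) - Real.pi * Complex.I := by
    apply Complex.ext
    · simp [Complex.log_re]
    · simp [Complex.log_im, Complex.arg_neg_eq_arg_sub_pi_of_im_pos (hp b)]
  have l2 : Complex.log (-Φ (-N, b)) = Complex.log (Φ (-N, b)) + Real.pi * Complex.I := by
    apply Complex.ext
    · simp [Complex.log_re]
    · simp [Complex.log_im, Complex.arg_neg_eq_arg_add_pi_of_im_neg (hm b)]
  simp only [one_mul, neg_mul, l1, l2] at e1 e2 e3 e4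
  have : (2 * Real.pi : ℂ) * Complex.I = 0 := by linear_combination e4 - e1 + e2 - e3
  simp [Real.pi_ne_zero] at this

/-- Chord lemma. -/
theorem chord (p : ℝ → ℂ) (hp : Continuous p) (e : ℤ) (he : 0 < e)
    (hper : ∀ s, p (s + 1) = p s + 2 * Real.pi * e * Complex.I) :
    ∃ s t, p s = p t + 2 * Real.pi * Complex.I := by
  have hq : Function.Periodic (fun s => (p s).re) 1 := fun s => by
    simp [hper]
  have hi : Function.Periodic (fun s => (p s).im - 2 * Real.pi * e * s) 1 := fun s => by
    simp [hper]; ring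
  obtain ⟨a, ha⟩ : ∃ a, ∀ s, (p a).re ≤ (p s).re := by
    obtain ⟨a, -, ha⟩ := isCompact_Icc.exists_isMinOn (s := Icc (0:ℝ) 1) ⟨0, by simp⟩
      (f := fun s => (p s).re) (by fun_prop)
    refine ⟨a, fun s => ?_⟩
    obtain ⟨y, hy, h⟩ := hq.exists_mem_Ico₀ one_pos s
    rw [h]; exact ha ⟨hy.1, hy.2.le⟩
  obtain ⟨b', hb'⟩ : ∃ a, ∀ s, (p s).re ≤ (p a).re := by
    obtain ⟨a, -, ha⟩ := isCompact_Icc.exists_isMaxOn (s := Icc (0:ℝ) 1) ⟨0, by simp⟩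
      (f := fun s => (p s).re) (by fun_prop)
    refine ⟨a, fun s => ?_⟩
    obtain ⟨y, hy, h⟩ := hq.exists_mem_Ico₀ one_pos s
    rw [h]; exact ha ⟨hy.1, hy.2.le⟩
  obtain ⟨b, hb, hbb⟩ := hq.exists_mem_Ico one_pos b' a
  obtain ⟨C, hC⟩ : ∃ C, ∀ s, |(p s).im - 2 * Real.pi * e * s| ≤ C := by
    obtain ⟨a, -, ha⟩ := isCompact_Icc.exists_isMaxOn (s := Icc (0:ℝ) 1) ⟨0, by simp⟩
      (f := fun s => |(p s).im - 2 * Real.pi * e * s|) (by fun_prop)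
    refine ⟨|(p a).im - 2 * Real.pi * e * a|, fun s => ?_⟩
    obtain ⟨y, hy, h⟩ := hi.exists_mem_Ico₀ one_pos s
    rw [h]; exact ha ⟨hy.1, hy.2.le⟩
  let κ : ℝ → ℝ := fun t => max a (min b t)
  have hκ : ∀ t, a ≤ κ t ∧ κ t ≤ b := fun t => ⟨le_max_left _ _, max_le hb.1 (min_le_left _ _)⟩
  have hκa : κ a = a := by simp [κ, hb.1]
  have hκb : κ b = b := by simp [κ, hb.1]
  have hC0 : 0 ≤ C := (abs_nonneg _).trans (hC 0)
  have hpi := Real.pi_gt_three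
  have he1 : (1:ℝ) ≤ e := by exact_mod_cast he
  let D := |a| + |b| + 2 * C + 2
  have hD : 0 ≤ D := by positivity
  have hk : ∀ t, |κ t| ≤ |a| + |b| := fun t => by
    have := hκ t
    rw [abs_le]
    constructor
    · linarith [neg_abs_le a, abs_nonneg b]
    · linarith [le_abs_self b, abs_nonneg a]
  have hE : 6 ≤ 2 * Real.pi * e := by nlinarith
  obtain ⟨⟨s, t⟩, h⟩ := miranda (fun q => p q.1 - p (κ q.2) - 2 * Real.pi * Complex.I)
    (by fun_prop) D a b (fun s => by simp [hκa, ha]) (fun s => by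
      simp [hκb, ← hbb, hb'])
    (fun t => by
      have h1 := abs_le.1 (hC D)
      have h2 := abs_le.1 (hC (κ t))
      have h3 := abs_le.1 (hk t)
      simp
      have : 2 * Real.pi * e * (D - κ t) ≥ 2 * Real.pi * e * (2 * C + 2) :=
        mul_le_mul_of_nonneg_left (by simp only [D]; linarith) (by positivity)
      have h5 : 2 * Real.pi * e * (2 * C) ≥ 6 * (2 * C) := mul_le_mul_of_nonneg_right hE (by positivity)
      have h6 : 2 * Real.pi * e * 2 ≥ 2 * Real.pi * 2 := by nlinarith
      nlinarith)
    (fun t => by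
      have h1 := abs_le.1 (hC (-D))
      have h2 := abs_le.1 (hC (κ t))
      have h3 := abs_le.1 (hk t)
      simp
      have : 2 * Real.pi * e * (D + κ t) ≥ 2 * Real.pi * e * (2 * C + 2) :=
        mul_le_mul_of_nonneg_left (by simp only [D]; linarith) (by positivity)
      have h5 : 2 * Real.pi * e * (2 * C) ≥ 6 * (2 * C) := mul_le_mul_of_nonneg_right hE (by positivity)
      have h6 : 2 * Real.pi * e * 2 ≥ 2 * Real.pi * 2 := by nlinarith
      nlinarith)
  exact ⟨s, κ t, by linear_combination h⟩

/-- Injectivity modulo the deck translation forces degree `±1`. -/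
theorem deg_one (L : ℝ → ℂ) (hL : Continuous L) (a b : ℝ) (hab : a < b) (e : ℤ) (he : e ≠ 0)
    (hb : L b = L a + 2 * Real.pi * e * Complex.I)
    (hinj : ∀ s ∈ Ico a b, ∀ t ∈ Ico a b, Complex.exp (L s) = Complex.exp (L t) → s = t) :
    e = 1 ∨ e = -1 := by
  let q : ℝ → ℂ := fun s => L (a + s * (b - a)) - 2 * Real.pi * e * s * Complex.I
  have hqc : Continuous fun s => q (Int.fract s) := by
    refine ContinuousOn.comp_fract'' (f := q) ?_ ?_
    · fun_prop
    · simp [q, hb]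
  let p : ℝ → ℂ := fun s => q (Int.fract s) + 2 * Real.pi * e * s * Complex.I
  have hp : Continuous p := hqc.add (by fun_prop)
  have hper : ∀ s, p (s + 1) = p s + 2 * Real.pi * e * Complex.I := by
    intro s; simp [p]; ring
  have hpe : ∀ s : ℝ, p s = L (a + Int.fract s * (b - a)) + 2 * Real.pi * e * ⌊s⌋ * Complex.I := by
    intro s
    have : (s : ℂ) = ⌊s⌋ + (Int.fract s : ℝ) := by exact_mod_cast (Int.floor_add_fract s).symm
    simp only [p, q]
    linear_combination (2 * Real.pi * e * Complex.I) * this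
  have hch : ∃ (s t : ℝ) (k : ℤ), (k = 1 ∨ k = -1) ∧ p s = p t + 2 * Real.pi * k * Complex.I := by
    rcases lt_or_gt_of_ne he with h | h
    · obtain ⟨s, t, hst⟩ := chord (fun s => p (-s)) (by fun_prop) (-e) (by omega) (fun s => by
        have := hper (-(s+1))
        rw [show -(s+1)+1 = -s by ring] at this
        push_cast
        linear_combination -this)
      exact ⟨-s, -t, 1, by simp, by simpa using hst⟩
    · obtain ⟨s, t, hst⟩ := chord p hp e h hper
      exact ⟨s, t, 1, by simp, by simpa using hst⟩
  obtain ⟨s, t, k, hk, hst⟩ := hch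
  rw [hpe, hpe] at hst
  have hm : ∀ s : ℝ, a + Int.fract s * (b - a) ∈ Ico a b := fun s => by
    have := Int.fract_nonneg s
    have := Int.fract_lt_one s
    constructor <;> nlinarith
  have := hinj _ (hm s) _ (hm t) (by
    rw [Complex.exp_eq_exp_iff_exists_int]
    refine ⟨e * ⌊t⌋ - e * ⌊s⌋ + k, ?_⟩
    push_cast
    linear_combination hst)
  rw [this] at hst
  have h2 : (2 * Real.pi * Complex.I) * ((e * (⌊s⌋ - ⌊t⌋) : ℂ) - k) = 0 := by
    linear_combination hst
  have h3 : (e * (⌊s⌋ - ⌊t⌋) : ℂ) - k = 0 := by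
    simpa [Real.pi_ne_zero] using h2
  have h4 : e * (⌊s⌋ - ⌊t⌋) = k := by
    exact_mod_cast sub_eq_zero.1 h3
  have h5 : IsUnit e := isUnit_of_dvd_unit ⟨_, h4.symm⟩ (by rcases hk with rfl | rfl <;> simp)
  exact Int.isUnit_iff.1 h5

theorem exists_lift (h : ℂ ≃ₜ ℂ) (hor : IsotopicToId ⇑h) (h0 : h 0 = 0) :
    ∃ G : ℝ → ℂ → ℂ, Continuous (Function.uncurry G) ∧ (∀ z, G 0 z = z) ∧
      (∀ t, Function.Injective (G t)) ∧ (∀ z, Complex.exp (G 1 z) = h (Complex.exp z)) ∧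
      ∀ t z (k : ℤ), G t (z + 2 * Real.pi * k * Complex.I) = G t z + 2 * Real.pi * k * Complex.I := by
  obtain ⟨F, hF, hF0, hF1, hbij⟩ := hor
  have hFc : ∀ {Y : Type} [TopologicalSpace Y] {p : Y → ℝ} {q : Y → ℂ}, Continuous p → Continuous q →
      Continuous fun y => F (p y) (q y) := fun hp hq => hF.comp (hp.prodMk hq)
  obtain ⟨Λ, hΛc, hΛ⟩ := exists_log (fun p : ℝ × ℂ => F p.1 (Complex.exp p.2) - F p.1 0)
    ((hFc (by fun_prop) (by fun_prop)).sub (hFc (by fun_prop) (by fun_prop)))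
    (fun p => sub_ne_zero.2 (fun h => Complex.exp_ne_zero _ ((hbij _).1 h)))
  have hexp : ∀ z (k : ℤ), Complex.exp (z + 2 * Real.pi * k * Complex.I) = Complex.exp z := by
    intro z k
    rw [Complex.exp_eq_exp_iff_exists_int]
    exact ⟨k, by ring⟩
  let c := Λ (0, 0)
  have hc : Complex.exp c = 1 := by simp [c, hΛ, hF0]
  have hG0 : ∀ z, Λ (0, z) - c = z := by
    intro z
    have := const_of_exp (fun z => Λ (0, z) - z) (by fun_prop) 1 (fun z => by
      rw [Complex.exp_sub, hΛ]; simp [hF0]) z 0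
    simp only [c]; linear_combination this
  have hper : ∀ t z (k : ℤ), Λ (t, z + 2 * Real.pi * k * Complex.I)
      = Λ (t, z) + 2 * Real.pi * k * Complex.I := by
    intro t z k
    have := const_of_exp (fun t => Λ (t, z + 2 * Real.pi * k * Complex.I) - Λ (t, z)) (by fun_prop) 1
      (fun t => by
        rw [Complex.exp_sub, hΛ, hΛ]
        simp only [hexp]
        exact div_self (sub_ne_zero.2 (fun h => Complex.exp_ne_zero _ ((hbij _).1 h)))) t 0
    linear_combination this + hG0 (z + 2 * Real.pi * k * Complex.I) - hG0 z
  refine ⟨fun t z => Λ (t, z) - c, ?_, hG0, ?_, ?_, ?_⟩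
  · exact hΛc.sub continuous_const
  · intro t z w hzw
    have h1 : Λ (t, z) = Λ (t, w) := by simpa using hzw
    have h2 := hΛ (t, z)
    rw [h1, hΛ] at h2
    have h3 := (hbij t).1 (sub_left_injective h2)
    simp only at h3
    obtain ⟨k, hk⟩ := Complex.exp_eq_exp_iff_exists_int.1 h3
    have h4 : w = z + 2 * Real.pi * k * Complex.I := by rw [hk]; ring
    have h5 := hper t z k
    rw [← h4, ← h1] at h5
    rw [h4]
    linear_combination h5
  · intro z
    rw [Complex.exp_sub, hΛ, hc]
    simp [hF1, h0]
  · intro t z k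
    simp only
    rw [hper]; ring

theorem three_arcs_pos (h : ℂ → ℂ)
    (hmod : ∀ γ : ℝ → ℂ, IsLoopIn γ → HasDeg γ 1 → ∀ l : ℕ, Decomp h γ l → 4 ≤ l)
    (L : ℝ → ℂ) (hL : Continuous L) (a b c d : ℝ) (hab : a ≤ b) (hbc : b ≤ c) (hcd : c ≤ d)
    (had : a < d) (hdeg : L d = L a + 2 * Real.pi * Complex.I)
    (f1 : ∀ s ∈ Icc a b, ∀ s' ∈ Icc a b, h (Complex.exp (L s)) ≠ Complex.exp (L s'))
    (f2 : ∀ s ∈ Icc b c, ∀ s' ∈ Icc b c, h (Complex.exp (L s)) ≠ Complex.exp (L s'))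
    (f3 : ∀ s ∈ Icc c d, ∀ s' ∈ Icc c d, h (Complex.exp (L s)) ≠ Complex.exp (L s')) : False := by
  have hP : 0 < d - a := by linarith
  have hd1 : L (a + 1 * (d - a)) = L a + 2 * Real.pi * Complex.I := by rw [← hdeg]; congr 1; ring
  have := hmod (fun τ => Complex.exp (L (a + τ * (d - a)))) ⟨by fun_prop, by
      simp only [hd1]
      simp [Complex.exp_add], fun t _ => Complex.exp_ne_zero _⟩
    ⟨fun τ => L (a + τ * (d - a)), by fun_prop, fun t _ => rfl, by
      simp only [hd1]
      simp⟩ 3 ?_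
  · omega
  have key : ∀ u v : ℝ, (∀ s ∈ Icc u v, ∀ s' ∈ Icc u v, h (Complex.exp (L s)) ≠ Complex.exp (L s')) →
      ∀ s ∈ Icc ((u - a) / (d - a)) ((v - a) / (d - a)), ∀ s' ∈ Icc ((u - a) / (d - a)) ((v - a) / (d - a)),
      h (Complex.exp (L (a + s * (d - a)))) ≠ Complex.exp (L (a + s' * (d - a))) := by
    intro u v huv s hs s' hs'
    have : ∀ s ∈ Icc ((u - a) / (d - a)) ((v - a) / (d - a)), a + s * (d - a) ∈ Icc u v := by
      intro s hs
      rw [mem_Icc, div_le_iff₀ hP, le_div_iff₀ hP] at hs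
      constructor <;> linarith
    exact huv _ (this s hs) _ (this s' hs')
  let T : ℕ → ℝ := fun i => match i with
    | 0 => a | 1 => b | 2 => c | _ => d
  refine ⟨fun i => (T i - a) / (d - a), by simp [T], by simp [T, hP.ne'], ?_, ?_⟩
  · intro i hi
    apply div_le_div_of_nonneg_right _ hP.le
    interval_cases i <;> simp [T, *]
  · intro i hi
    apply key
    interval_cases i
    · exact f1
    · exact f2
    · exact f3

theorem three_arcs (h : ℂ → ℂ)
    (hmod : ∀ γ : ℝ → ℂ, IsLoopIn γ → HasDeg γ 1 → ∀ l : ℕ, Decomp h γ l → 4 ≤ l)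
    (L : ℝ → ℂ) (hL : Continuous L) (a b c d : ℝ) (hab : a ≤ b) (hbc : b ≤ c) (hcd : c ≤ d)
    (had : a < d) (e : ℤ) (he : e = 1 ∨ e = -1) (hdeg : L d = L a + 2 * Real.pi * e * Complex.I)
    (f1 : ∀ s ∈ Icc a b, ∀ s' ∈ Icc a b, h (Complex.exp (L s)) ≠ Complex.exp (L s'))
    (f2 : ∀ s ∈ Icc b c, ∀ s' ∈ Icc b c, h (Complex.exp (L s)) ≠ Complex.exp (L s'))
    (f3 : ∀ s ∈ Icc c d, ∀ s' ∈ Icc c d, h (Complex.exp (L s)) ≠ Complex.exp (L s')) : False := by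
  rcases he with rfl | rfl
  · exact three_arcs_pos h hmod L hL a b c d hab hbc hcd had (by simpa using hdeg) f1 f2 f3
  · have hm : ∀ {u v s : ℝ}, s ∈ Icc (-u) (-v) → -s ∈ Icc v u := fun hs =>
      ⟨by linarith [hs.2], by linarith [hs.1]⟩
    refine three_arcs_pos h hmod (fun s => L (-s)) (by fun_prop) (-d) (-c) (-b) (-a) (by linarith)
      (by linarith) (by linarith) (by linarith) ?_ ?_ ?_ ?_
    · simp [hdeg]
    · exact fun s hs s' hs' => f3 _ (hm hs) _ (hm hs')
    · exact fun s hs s' hs' => f2 _ (hm hs) _ (hm hs')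
    · exact fun s hs s' hs' => f1 _ (hm hs) _ (hm hs')

theorem contact (h : ℂ ≃ₜ ℂ) (hfix : ∀ x : ℂ, h x = x ↔ x = 0) (x : ℂ) :
    ∃ (R : ℝ) (y y' : ℂ), 0 < R ∧ dist y x = R ∧ dist y' x = R ∧ h (Complex.exp y) = Complex.exp y' ∧
      ∀ u v, dist u x ≤ R → dist v x ≤ R → h (Complex.exp u) = Complex.exp v →
        dist u x = R ∧ dist v x = R := by
  have hne : ∀ u, h (Complex.exp u) ≠ Complex.exp u := fun u hu =>
    Complex.exp_ne_zero u ((hfix _).1 hu)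
  have hh0 : h 0 = 0 := (hfix 0).2 rfl
  have hnz : ∀ u, h (Complex.exp u) ≠ 0 := fun u hu =>
    Complex.exp_ne_zero u (h.injective (hu.trans hh0.symm))
  let x' := Complex.log (h (Complex.exp x))
  have hx' : h (Complex.exp x) = Complex.exp x' := (Complex.exp_log (hnz x)).symm
  let S : Set (ℂ × ℂ) := {p | h (Complex.exp p.1) = Complex.exp p.2}
  have hS : IsClosed S := isClosed_eq (by fun_prop) (by fun_prop)
  let K := S ∩ Metric.closedBall (x, x) (dist x' x)
  have hK : IsCompact K := (isCompact_closedBall _ _).inter_left hS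
  have hxK : (x, x') ∈ K := ⟨hx', by simp [Prod.dist_eq]⟩
  obtain ⟨⟨y, y'⟩, hyK, hmin⟩ := hK.exists_isMinOn ⟨_, hxK⟩ (f := fun p => dist p (x, x))
    (by fun_prop)
  let R := dist (y, y') (x, x)
  have hR : ∀ u v, h (Complex.exp u) = Complex.exp v → R ≤ max (dist u x) (dist v x) := by
    intro u v huv
    by_cases hin : (u, v) ∈ Metric.closedBall (x, x) (dist x' x)
    · have := hmin ⟨huv, hin⟩
      exact this
    · have h1 : R ≤ dist x' x := hyK.2
      rw [Metric.mem_closedBall, not_le] at hin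
      exact h1.trans hin.le
  have hSy : h (Complex.exp y) = Complex.exp y' := hyK.1
  have hR0 : 0 < R := by
    refine dist_pos.2 fun heq => ?_
    obtain ⟨rfl, h2⟩ := Prod.mk.inj heq
    rw [h2] at hSy
    exact hne _ hSy
  have hcl : ∀ u, dist u x ≤ R → u ∈ closure (Metric.ball x R) := fun u hu => by
    rw [closure_ball x hR0.ne']; exact hu
  have hE : IsOpen (Complex.exp '' Metric.ball x R) := Complex.isOpenMap_exp _ Metric.isOpen_ball
  have hA : ∀ u v, dist u x ≤ R → dist v x < R → h (Complex.exp u) ≠ Complex.exp v := by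
    intro u v hu hv huv
    obtain ⟨u', ⟨v', hv', h1⟩, hu'⟩ := mem_closure_iff.1 (hcl u hu)
      ((fun u => h (Complex.exp u)) ⁻¹' (Complex.exp '' Metric.ball x R))
      (hE.preimage (by fun_prop)) ⟨v, hv, huv.symm⟩
    exact absurd (hR u' v' h1.symm) (not_le.2 (max_lt hu' hv'))
  have hB : ∀ u v, dist u x < R → dist v x ≤ R → h (Complex.exp u) ≠ Complex.exp v := by
    intro u v hu hv huv
    obtain ⟨v', ⟨u', hu', h1⟩, hv'⟩ := mem_closure_iff.1 (hcl v hv)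
      ((fun u => h.symm (Complex.exp u)) ⁻¹' (Complex.exp '' Metric.ball x R))
      (hE.preimage (by fun_prop)) ⟨u, hu, by simp [← huv]⟩
    exact absurd (hR u' v' (by simp [h1])) (not_le.2 (max_lt hu' hv'))
  have hfin : ∀ u v, dist u x ≤ R → dist v x ≤ R → h (Complex.exp u) = Complex.exp v →
        dist u x = R ∧ dist v x = R := by
    intro u v hu hv huv
    constructor
    · by_contra hc
      exact hB u v (lt_of_le_of_ne hu hc) hv huv
    · by_contra hc
      exact hA u v hu (lt_of_le_of_ne hv hc) huv
  have := hfin y y' (le_max_left _ _) (le_max_right _ _) hSy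
  exact ⟨R, y, y', hR0, this.1, this.2, hSy, hfin⟩

theorem stmt6 (h : ℂ ≃ₜ ℂ) (hor : IsotopicToId ⇑h)
    (hfix : ∀ x : ℂ, h x = x ↔ x = 0)
    (hmod : ∀ γ : ℝ → ℂ, IsLoopIn γ → HasDeg γ 1 → ∀ l : ℕ, Decomp (⇑h) γ l → 4 ≤ l) :
    ¬ ∃ x : ℂ, x ≠ 0 ∧ h x ≠ x ∧ h (h x) = x := by
  rintro ⟨x₀, hx0, -, hxx⟩
  have hne : ∀ u, h (Complex.exp u) ≠ Complex.exp u := fun u hu =>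
    Complex.exp_ne_zero u ((hfix _).1 hu)
  obtain ⟨x, rfl⟩ : ∃ x, x₀ = Complex.exp x := ⟨_, (Complex.exp_log hx0).symm⟩
  obtain ⟨G, hGc, hG0, hGinj, hG1, -⟩ := exists_lift h hor ((hfix 0).2 rfl)
  obtain ⟨R, y, y', hR, hy, hy', hyy, hcon⟩ := contact h hfix x
  have hRpi : R < Real.pi := by
    by_contra! hRp
    have hfree : ∀ s ∈ Icc (-1 : ℝ) 1, ∀ s' ∈ Icc (-1 : ℝ) 1,
        h (Complex.exp (x + s * Real.pi * Complex.I)) ≠ Complex.exp (x + s' * Real.pi * Complex.I) := by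
      have hd : ∀ s : ℝ, dist (x + s * Real.pi * Complex.I) x = |s| * Real.pi := fun s => by
        simp [dist_eq_norm, abs_of_pos Real.pi_pos]
      have hs1 : ∀ s ∈ Icc (-1 : ℝ) 1, |s| * Real.pi ≤ R := fun s hs => by
        have := abs_le.2 hs
        nlinarith [Real.pi_pos]
      have hs2 : ∀ s ∈ Icc (-1 : ℝ) 1, |s| * Real.pi = R →
          Complex.exp (x + s * Real.pi * Complex.I) = - Complex.exp x := fun s hs hsR => by
        have h1 := abs_le.2 hs
        have h2 : |s| = 1 := by nlinarith [Real.pi_pos]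
        rcases (abs_eq zero_le_one).1 h2 with rfl | rfl
        · simp [Complex.exp_add]
        · simp [Complex.exp_add, Complex.exp_neg]
      intro s hs s' hs' heq
      have := hcon _ _ ((hd s).trans_le (hs1 s hs)) ((hd s').trans_le (hs1 s' hs')) heq
      rw [hd, hd] at this
      refine hne (x + s * Real.pi * Complex.I) ?_
      rw [heq, hs2 s hs this.1, hs2 s' hs' this.2]
    have hc : ∀ s ∈ Icc (1 : ℝ) 1, s ∈ Icc (-1 : ℝ) 1 := fun s hs => ⟨by linarith [hs.1], hs.2⟩
    refine three_arcs h hmod (fun s => x + s * Real.pi * Complex.I) (by fun_prop) (-1) 1 1 1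
      (by norm_num) le_rfl le_rfl (by norm_num) 1 (by simp) ?_ hfree
      (fun s hs s' hs' => hfree s (hc s hs) s' (hc s' hs'))
      (fun s hs s' hs' => hfree s (hc s hs) s' (hc s' hs'))
    push_cast; ring
  -- choose the lift adapted to the contact point
  obtain ⟨k, hk⟩ : ∃ k : ℤ, y' = G 1 y + 2 * Real.pi * k * Complex.I := by
    have h1 : Complex.exp y' = Complex.exp (G 1 y) := by rw [hG1, hyy]
    obtain ⟨k, hk⟩ := Complex.exp_eq_exp_iff_exists_int.1 h1
    exact ⟨k, by rw [hk]; ring⟩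
  let I : ℝ → ℂ → ℂ := fun t z => G t z + 2 * Real.pi * k * t * Complex.I
  have hIc : Continuous (Function.uncurry I) := by
    have : Function.uncurry I = fun p => Function.uncurry G p + 2 * Real.pi * k * p.1 * Complex.I := rfl
    rw [this]; fun_prop
  have hI0 : ∀ z, I 0 z = z := fun z => by simp [I, hG0]
  have hIinj : ∀ t, Function.Injective (I t) := fun t z w hzw => hGinj t (by simpa [I] using hzw)
  obtain ⟨g, hg⟩ : ∃ g, g = I 1 := ⟨_, rfl⟩
  have hgc : Continuous g := by
    rw [hg]; exact hIc.comp (continuous_const.prodMk continuous_id)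
  have hgexp : ∀ z, Complex.exp (g z) = h (Complex.exp z) := fun z => by
    rw [← hG1, Complex.exp_eq_exp_iff_exists_int]
    exact ⟨k, by simp [hg, I]; ring⟩
  have hgy : g y = y' := by rw [hk]; simp [hg, I]
  clear_value I
  -- the arc through the periodic point
  let β : ℝ → ℂ := fun t => x + ((max (1 - 2 * t) 0 : ℝ) : ℂ) * (y - x)
    + ((max (2 * t - 1) 0 : ℝ) : ℂ) * (y' - x)
  have hβc : Continuous β := by fun_prop
  have hβ1 : ∀ t, t ≤ 1 / 2 → β t = x + ((1 - 2 * t : ℝ) : ℂ) * (y - x) := fun t ht => by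
    simp only [β]
    rw [max_eq_left (by linarith), max_eq_right (by linarith)]; simp
  have hβ2 : ∀ t, 1 / 2 ≤ t → β t = x + ((2 * t - 1 : ℝ) : ℂ) * (y' - x) := fun t ht => by
    simp only [β]
    rw [max_eq_right (by linarith), max_eq_left (by linarith)]; simp
  have hβ_0 : β 0 = y := by rw [hβ1 0 (by norm_num)]; simp
  have hβ_1 : β 1 = y' := by rw [hβ2 1 (by norm_num)]; push_cast; ring
  have hβ_h : β (1 / 2) = x := by rw [hβ2 _ le_rfl]; simp
  have hβd : ∀ t, dist (β t) x = |1 - 2 * t| * R := fun t => by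
    rcases le_total t (1 / 2) with ht | ht
    · rw [hβ1 t ht, dist_eq_norm, add_sub_cancel_left, norm_mul, ← dist_eq_norm, hy,
        Complex.norm_real, Real.norm_eq_abs]
    · rw [hβ2 t ht, dist_eq_norm, add_sub_cancel_left, norm_mul, ← dist_eq_norm, hy',
        Complex.norm_real, Real.norm_eq_abs, abs_sub_comm]
  clear_value β
  have habs : ∀ t ∈ Icc (0 : ℝ) 1, |1 - 2 * t| ≤ 1 := fun t ht =>
    abs_le.2 ⟨by linarith [ht.2], by linarith [ht.1]⟩
  have hβR : ∀ t ∈ Icc (0 : ℝ) 1, dist (β t) x ≤ R := fun t ht => by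
    rw [hβd]; nlinarith [habs t ht]
  have hyne : y ≠ y' := fun h1 => by
    rw [← h1] at hyy; exact hne _ hyy
  obtain ⟨b, hb⟩ : ∃ b : ℝ → ℂ, b = fun t => Complex.exp (β t) := ⟨_, rfl⟩
  have hbc : Continuous b := by rw [hb]; fun_prop
  have hb' : ∀ t, Complex.exp (β t) = b t := fun t => by rw [hb]
  have hbne : ∀ t, h (b t) ≠ b t := fun t => by rw [← hb']; exact hne _
  have hpair : ∀ s ∈ Icc (0 : ℝ) 1, ∀ t ∈ Icc (0 : ℝ) 1, h (b s) = b t →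
      (s = 0 ∧ t = 1) ∨ (s = 1 ∧ t = 0) := by
    intro s hs t ht hst
    have h1 := hcon (β s) (β t) (hβR s hs) (hβR t ht) (by simpa [hb'] using hst)
    rw [hβd, hβd] at h1
    have h2 : |1 - 2 * s| = 1 := by nlinarith [h1.1]
    have h3 : |1 - 2 * t| = 1 := by nlinarith [h1.2]
    have hst' : s ≠ t := fun h => by rw [h] at hst; exact hbne _ hst
    rcases (abs_eq zero_le_one).1 h2 with h2 | h2 <;> rcases (abs_eq zero_le_one).1 h3 with h3 | h3
    · exact absurd (by linarith) hst'
    · left; constructor <;> linarith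
    · right; constructor <;> linarith
    · exact absurd (by linarith) hst'
  have hflip : ∀ t, t < 1 / 2 → β (1 - t) ≠ β t := by
    intro t ht heq
    rw [hβ1 t ht.le, hβ2 (1 - t) (by linarith), show 2 * (1 - t) - 1 = 1 - 2 * t by ring] at heq
    have h1 : ((1 - 2 * t : ℝ) : ℂ) ≠ 0 := by
      rw [Complex.ofReal_ne_zero]; linarith
    have h2 := mul_left_cancel₀ h1 (add_left_cancel heq)
    exact hyne (by linear_combination -h2)
  have hbinj : ∀ s ∈ Icc (0 : ℝ) 1, ∀ t ∈ Icc (0 : ℝ) 1, b s = b t → s = t := by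
    intro s hs t ht hst
    rw [← hb', ← hb'] at hst
    obtain ⟨n, hn⟩ := Complex.exp_eq_exp_iff_exists_int.1 hst
    have hd : dist (β s) (β t) ≤ R + R := (dist_triangle_right _ _ x).trans
      (add_le_add (hβR s hs) (hβR t ht))
    have hn0 : n = 0 := by
      rw [hn, dist_eq_norm, add_sub_cancel_left] at hd
      simp only [norm_mul, Complex.norm_intCast, Complex.norm_real, Complex.norm_I,
        Complex.norm_ofNat, mul_one, Real.norm_eq_abs, abs_of_pos Real.pi_pos] at hd
      have : |(n : ℝ)| < 1 := by nlinarith [Real.pi_pos]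
      have : |n| < 1 := by exact_mod_cast this
      exact Int.abs_lt_one_iff.1 this
    have heq : β s = β t := by simpa [hn0] using hn
    have h1 : |1 - 2 * s| = |1 - 2 * t| := by
      have := congrArg (fun z => dist z x) heq
      simp only [hβd] at this
      exact mul_right_cancel₀ hR.ne' this
    rcases abs_eq_abs.1 h1 with h2 | h2
    · linarith
    · rcases lt_trichotomy t (1 / 2) with h3 | h3 | h3
      · exact absurd (by rw [← heq]; congr 1; linarith) (hflip t h3)
      · linarith
      · exact absurd (by rw [heq]; congr 1; linarith) (hflip s (by linarith))
  -- the long path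
  obtain ⟨L, hL⟩ : ∃ L : ℝ → ℂ, L = fun t => if t ≤ 1 then β t else if t ≤ 2 then g (β (t - 1))
    else g (g (β (t - 2))) := ⟨_, rfl⟩
  have hLc : Continuous L := by
    rw [hL]
    refine Continuous.if_le hβc (Continuous.if_le (by fun_prop) (by fun_prop) continuous_id
      continuous_const ?_) continuous_id continuous_const ?_
    · rintro t rfl
      norm_num [hβ_1, hβ_0, hgy]
    · rintro t rfl
      norm_num [hβ_1, hβ_0, hgy]
  have hL1 : ∀ t, t ≤ 1 → L t = β t := fun t ht => by simp [hL, ht]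
  have hL2 : ∀ t, 1 ≤ t → t ≤ 2 → L t = g (β (t - 1)) := fun t ht ht' => by
    rcases ht.eq_or_lt with rfl | h1
    · norm_num [hL, hβ_1, hβ_0, hgy]
    · simp [hL, ht', not_le.2 h1]
  have hL3 : ∀ t, 2 ≤ t → L t = g (g (β (t - 2))) := fun t ht => by
    rcases ht.eq_or_lt with rfl | h1
    · norm_num [hL, hβ_1, hβ_0, hgy]
    · simp [hL, not_le.2 h1, not_le.2 (one_lt_two.trans h1)]
  have hE1 : ∀ t, t ≤ 1 → Complex.exp (L t) = b t := fun t ht => by rw [hL1 t ht, hb']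
  have hE2 : ∀ t, 1 ≤ t → t ≤ 2 → Complex.exp (L t) = h (b (t - 1)) := fun t ht ht' => by
    rw [hL2 t ht ht', hgexp, hb']
  have hE3 : ∀ t, 2 ≤ t → Complex.exp (L t) = h (h (b (t - 2))) := fun t ht => by
    rw [hL3 t ht, hgexp, hgexp, hb']
  let Q : Set (ℝ × ℝ) := (Icc (1 / 2) 1 ×ˢ Icc 2 (5 / 2)) ∩ {p | h (h (b (p.2 - 2))) = b p.1}
  have hQ : IsCompact Q := (isCompact_Icc.prod isCompact_Icc).inter_right
    (isClosed_eq (by fun_prop) (by fun_prop))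
  have hQne : ((1 / 2, 5 / 2) : ℝ × ℝ) ∈ Q := by
    refine ⟨⟨by norm_num, by norm_num⟩, ?_⟩
    have : (5 / 2 - 2 : ℝ) = 1 / 2 := by norm_num
    simp only [mem_ofPred_eq, this]
    rw [← hb', hβ_h, hxx]
  obtain ⟨⟨s₀, t₀⟩, ⟨⟨hs₀, ht₀⟩, hst₀⟩, hmin⟩ := hQ.exists_isMinOn ⟨_, hQne⟩ (f := Prod.snd)
    (by fun_prop)
  simp only [mem_ofPred_eq, mem_Icc] at hs₀ ht₀ hst₀
  have hfirst : ∀ s t, 1 / 2 ≤ s → s ≤ 1 → 2 ≤ t → t ≤ 5 / 2 → h (h (b (t - 2))) = b s → t₀ ≤ t :=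
    fun s t h1 h2 h3 h4 h5 => hmin (show (s, t) ∈ Q from ⟨⟨⟨h1, h2⟩, ⟨h3, h4⟩⟩, h5⟩)
  have hb01 : b 1 = h (b 0) := by rw [← hb', ← hb', hβ_1, hβ_0, hyy]
  have hs1 : s₀ < 1 := by
    refine lt_of_le_of_ne hs₀.2 fun h1 => ?_
    rw [h1, hb01] at hst₀
    have h2 := hpair (t₀ - 2) ⟨by linarith, by linarith⟩ 0 (by simp) (h.injective hst₀)
    rcases h2 with h2 | h2 <;> linarith
  obtain ⟨e, he⟩ : ∃ e : ℤ, L t₀ = L s₀ + 2 * Real.pi * e * Complex.I := by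
    have h1 : Complex.exp (L t₀) = Complex.exp (L s₀) := by
      rw [hE3 _ ht₀.1, hE1 _ hs₀.2, hst₀]
    obtain ⟨e, he⟩ := Complex.exp_eq_exp_iff_exists_int.1 h1
    exact ⟨e, by rw [he]; ring⟩
  have he0 : e ≠ 0 := by
    rintro rfl
    have h1 : g (g (β (t₀ - 2))) = β s₀ := by
      rw [← hL3 _ ht₀.1, ← hL1 _ hs₀.2, he]; simp
    let κ : ℝ → ℝ := fun τ => s₀ + max 0 (min 1 τ) * (t₀ - 2 - s₀)
    have hκ0 : κ 0 = s₀ := by simp [κ]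
    have hκ1 : κ 1 = t₀ - 2 := by simp [κ]
    have hκc : Continuous κ := by fun_prop
    have hκ : ∀ τ, 0 ≤ κ τ ∧ κ τ < 1 := fun τ => by
      have h2 : 0 ≤ max 0 (min 1 τ) := le_max_left _ _
      have h3 : max 0 (min 1 τ) ≤ 1 := max_le zero_le_one (min_le_left _ _)
      simp only [κ]
      constructor <;> nlinarith
    refine no_two_chain I hIc hI0 hIinj (fun z hz => ?_) (fun τ => β (κ τ)) (by fun_prop)
      (fun u v huv => ?_) (by simp only [hκ0, hκ1, ← hg]; exact h1)
    · rw [← hg] at hz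
      exact hne z (by rw [← hgexp, hz])
    · rw [← hg] at huv
      have h2 := congrArg Complex.exp huv
      rw [hgexp, hb', hb'] at h2
      rcases hpair _ ⟨(hκ u).1, (hκ u).2.le⟩ _ ⟨(hκ v).1, (hκ v).2.le⟩ h2 with h3 | h3
      · exact absurd h3.2 (hκ v).2.ne
      · exact absurd h3.1 (hκ u).2.ne
  have he1 : e = 1 ∨ e = -1 := by
    refine deg_one L hLc s₀ t₀ (by linarith) e he0 he ?_
    have main : ∀ s ∈ Ico s₀ t₀, ∀ t ∈ Ico s₀ t₀, s ≤ t →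
        Complex.exp (L s) = Complex.exp (L t) → s = t := by
      intro s hs t ht hst heq
      have hs' := hs.1
      have ht' := ht.2
      rcases le_total t 1 with h1 | h1
      · rw [hE1 _ h1, hE1 s (by linarith)] at heq
        exact hbinj s ⟨by linarith, by linarith⟩ t ⟨by linarith, h1⟩ heq
      rcases le_total t 2 with h2 | h2
      · rw [hE2 _ h1 h2] at heq
        rcases le_total s 1 with h3 | h3
        · rw [hE1 _ h3] at heq
          rcases hpair (t - 1) ⟨by linarith, by linarith⟩ s ⟨by linarith, h3⟩ heq.symm with h4 | h4
          · linarith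
          · linarith
        · rw [hE2 _ h3 (by linarith)] at heq
          have := hbinj _ ⟨by linarith, by linarith⟩ _ ⟨by linarith, by linarith⟩ (h.injective heq)
          linarith
      · rw [hE3 _ h2] at heq
        rcases le_total s 1 with h3 | h3
        · rw [hE1 _ h3] at heq
          have := hfirst s t (by linarith) h3 h2 (by linarith) heq.symm
          linarith
        rcases le_total s 2 with h4 | h4
        · rw [hE2 _ h3 h4] at heq
          rcases hpair (t - 2) ⟨by linarith, by linarith⟩ (s - 1) ⟨by linarith, by linarith⟩
            (h.injective heq).symm with h5 | h5 <;> linarith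
        · rw [hE3 _ h4] at heq
          have := hbinj _ ⟨by linarith, by linarith⟩ _ ⟨by linarith, by linarith⟩
            (h.injective (h.injective heq))
          linarith
    intro s hs t ht heq
    rcases le_total s t with h1 | h1
    · exact main s hs t ht h1 heq
    · exact (main t ht s hs h1 heq.symm).symm
  refine three_arcs h hmod L hLc s₀ 1 (1 + (1 + s₀) / 2) t₀ hs₀.2 (by linarith) (by linarith)
    (by linarith) e he1 he ?_ ?_ ?_
  · rintro s ⟨h1, h2⟩ t ⟨h3, h4⟩ heq
    rw [hE1 _ h2, hE1 _ h4] at heq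
    rcases hpair s ⟨by linarith, h2⟩ t ⟨by linarith, h4⟩ heq with h5 | h5 <;> linarith
  · rintro s ⟨h1, h2⟩ t ⟨h3, h4⟩ heq
    rw [hE2 _ h1 (by linarith), hE2 _ h3 (by linarith)] at heq
    rcases hpair (s - 1) ⟨by linarith, by linarith⟩ (t - 1) ⟨by linarith, by linarith⟩
      (h.injective heq) with h5 | h5 <;> linarith
  · rintro s ⟨h1, h2⟩ t ⟨h3, h4⟩ heq
    rcases le_total s 2 with h5 | h5 <;> rcases le_total t 2 with h6 | h6
    · rw [hE2 _ (by linarith) h5, hE2 _ (by linarith) h6] at heq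
      rcases hpair (s - 1) ⟨by linarith, by linarith⟩ (t - 1) ⟨by linarith, by linarith⟩
        (h.injective heq) with h7 | h7 <;> linarith
    · rw [hE2 _ (by linarith) h5, hE3 _ h6] at heq
      have := hbinj (s - 1) ⟨by linarith, by linarith⟩ (t - 2) ⟨by linarith, by linarith⟩
        (h.injective (h.injective heq))
      linarith
    · rw [hE3 _ h5, hE2 _ (by linarith) h6] at heq
      have heq := h.injective heq
      have h7 := hfirst (t - 1) s (by linarith) (by linarith) h5 (by linarith) heq
      have h8 : s = t₀ := le_antisymm h2 h7
      rw [h8, hst₀] at heq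
      have := hbinj s₀ ⟨by linarith, by linarith⟩ (t - 1) ⟨by linarith, by linarith⟩ heq
      linarith
    · rw [hE3 _ h5, hE3 _ h6] at heq
      rcases hpair (s - 2) ⟨by linarith, by linarith⟩ (t - 2) ⟨by linarith, by linarith⟩
        (h.injective (h.injective heq)) with h7 | h7 <;> linarith
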